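/- arXiv:2307.11690 — 2 statements merged into one kernel-verified Lean document; each statement's English description precedes it below -/
import Mathlib

section
/- The map b : [0,1] → 2^ω is continuous with respect to the Besicovitch pseudodistance: for every r ∈ [0,1] and every ε > 0 there is δ > 0 such that for all r' ∈ [0,1] with |r − r'| < δ, one has d(b(r), b(r')) < ε. -/
open Filter

/-- The Besicovitch pseudodistance on `2^ω`:
`d(X,Y) = limsup_{n→∞} |{m < n : X(m) ≠ Y(m)}|/n`. -/
noncomputable def besic (X Y : ℕ → Bool) : ℝ :=
  Filter.limsup
    (fun n => (((Finset.range n).filter (fun m => X m ≠ Y m)).card : ℝ) / n)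
    Filter.atTop

/-- The dyadic threshold `t n` such that `b(r)(n) = 1 ↔ r ≥ t n`.
It satisfies `t 0 = 1`, `t (2n) = (1 + t n)/2` (for `n ≥ 1`) and `t (2n+1) = t n / 2`. -/
noncomputable def bThresh : ℕ → ℝ
  | 0 => 1
  | (n + 1) =>
      if (n + 1) % 2 = 0 then (1 + bThresh ((n + 1) / 2)) / 2
      else bThresh ((n + 1) / 2) / 2
decreasing_by all_goals exact Nat.div_lt_self (Nat.succ_pos n) one_lt_two

/-- The sequence `b(r) ∈ 2^ω` from the recursion `b(0) = 0^ω`, `b(1) = 1^ω`,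
`b(r) = 0^ω ⊕ b(2r)` for `0 < r ≤ 1/2` and `b(r) = b(2r−1) ⊕ 1^ω` for `1/2 ≤ r < 1`
(each bit is determined at a finite stage; this closed form records precisely the
outcome of that recursion: bit `n` of `b(r)` is `1` iff `r ≥ t n`). -/
noncomputable def bseq (r : ℝ) (n : ℕ) : Bool := decide (bThresh n ≤ r)

/-- Number of ones of `X` among positions `< n`. -/
def onesCount (X : ℕ → Bool) (n : ℕ) : ℕ :=
  ((Finset.range n).filter (fun m => X m = true)).card

lemma bThresh_even (n : ℕ) : bThresh (2 * n) = (1 + bThresh n) / 2 := by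
  rcases eq_or_ne n 0 with rfl | hn
  · norm_num [bThresh]
  · obtain ⟨k, hk⟩ : ∃ k, 2 * n = k + 1 := ⟨2 * n - 1, by omega⟩
    rw [hk, bThresh, if_pos (by omega), show (k + 1) / 2 = n by omega]

lemma bThresh_odd (n : ℕ) : bThresh (2 * n + 1) = bThresh n / 2 := by
  rw [bThresh, if_neg (by omega), show (2 * n + 1) / 2 = n by omega]

lemma bThresh_mem_Ioc (n : ℕ) : bThresh n ∈ Set.Ioc (0 : ℝ) 1 := by
  induction n using Nat.strong_induction_on with
  | _ n ih =>
    rcases Nat.even_or_odd' n with ⟨m, rfl | rfl⟩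
    · rcases eq_or_ne m 0 with rfl | hm
      · norm_num [bThresh]
      · obtain ⟨h0, h1⟩ := ih m (by omega)
        rw [bThresh_even]
        constructor <;> linarith
    · obtain ⟨h0, h1⟩ := ih m (by omega)
      rw [bThresh_odd]
      constructor <;> linarith

/-- The index of the dyadic cell `((j - 1) / 2 ^ k, j / 2 ^ k]` containing `bThresh n`. -/
noncomputable def bThreshCell (k n : ℕ) : ℤ := ⌈(2 : ℝ) ^ k * bThresh n⌉

lemma bThreshCell_pos (k n : ℕ) : 0 < bThreshCell k n :=
  Int.ceil_pos.2 (mul_pos (by positivity) (bThresh_mem_Ioc n).1)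

lemma bThreshCell_le (k n : ℕ) : bThreshCell k n ≤ 2 ^ k := by
  refine Int.ceil_le.2 ?_
  push_cast
  exact mul_le_of_le_one_right (by positivity) (bThresh_mem_Ioc n).2

lemma bThreshCell_succ_even (k n : ℕ) :
    bThreshCell (k + 1) (2 * n) = bThreshCell k n + 2 ^ k := by
  rw [bThreshCell, bThreshCell, bThresh_even,
    show (2 : ℝ) ^ (k + 1) * ((1 + bThresh n) / 2) = 2 ^ k * bThresh n + ((2 ^ k : ℤ) : ℝ) by
      push_cast; ring, Int.ceil_add_intCast]

lemma bThreshCell_succ_odd (k n : ℕ) :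
    bThreshCell (k + 1) (2 * n + 1) = bThreshCell k n := by
  rw [bThreshCell, bThreshCell, bThresh_odd]
  congr 1
  ring

/-- Indices whose thresholds share a dyadic cell of level `k` are congruent modulo `2 ^ k`. -/
lemma modEq_of_bThreshCell_eq (k : ℕ) {m n : ℕ} (h : bThreshCell k m = bThreshCell k n) :
    m ≡ n [MOD 2 ^ k] := by
  induction k generalizing m n with
  | zero => simpa using Nat.modEq_one
  | succ k ih =>
    rcases Nat.even_or_odd' m with ⟨a, rfl | rfl⟩ <;>
    rcases Nat.even_or_odd' n with ⟨b, rfl | rfl⟩ <;>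
    simp only [bThreshCell_succ_even, bThreshCell_succ_odd] at h
    · rw [pow_succ']
      exact (ih (by linarith)).mul_left' 2
    · linarith [bThreshCell_pos k a, bThreshCell_le k b]
    · linarith [bThreshCell_pos k b, bThreshCell_le k a]
    · rw [pow_succ']
      exact ((ih h).mul_left' 2).add_right 1

lemma card_filter_bThreshCell_eq_le (k N : ℕ) (c : ℤ) :
    ((Finset.range N).filter (fun m => bThreshCell k m = c)).card ≤ N / 2 ^ k + 1 := by
  rw [← Finset.card_range (N / 2 ^ k + 1)]
  refine Finset.card_le_card_of_injOn (fun m => m / 2 ^ k) ?_ ?_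
  · intro m hm
    simp only [Finset.coe_filter, Finset.mem_range, Set.mem_ofPred_eq, Finset.coe_range,
      Set.mem_Iio] at hm ⊢
    exact Nat.lt_succ_of_le (Nat.div_le_div_right hm.1.le)
  · intro m hm n hn hmn
    simp only [Finset.coe_filter, Finset.mem_range, Set.mem_ofPred_eq] at hm hn hmn
    have hmod : m % 2 ^ k = n % 2 ^ k := modEq_of_bThreshCell_eq k (hm.2.trans hn.2.symm)
    rw [← Nat.div_add_mod m (2 ^ k), ← Nat.div_add_mod n (2 ^ k), hmn, hmod]

lemma bThresh_mem_Ioc_of_bseq_ne {r s : ℝ} {m : ℕ} (h : bseq r m ≠ bseq s m) :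
    bThresh m ∈ Set.Ioc (min r s) (max r s) := by
  simp only [bseq, ne_eq, decide_eq_decide] at h
  simp only [Set.mem_Ioc, min_lt_iff, le_max_iff]
  by_cases h1 : bThresh m ≤ r <;> by_cases h2 : bThresh m ≤ s <;> simp_all

lemma card_filter_bseq_ne_le (k N : ℕ) {r s : ℝ} (h : |r - s| < (1 / 2) ^ k) :
    ((Finset.range N).filter (fun m => bseq r m ≠ bseq s m)).card ≤ 2 * (N / 2 ^ k + 1) := by
  set c : ℤ := ⌈(2 : ℝ) ^ k * min r s⌉ with hc
  have hsub : (Finset.range N).filter (fun m => bseq r m ≠ bseq s m) ⊆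
      (Finset.range N).filter (fun m => bThreshCell k m = c) ∪
        (Finset.range N).filter (fun m => bThreshCell k m = c + 1) := by
    intro m hm
    rw [Finset.mem_filter] at hm
    obtain ⟨hmN, hne⟩ := hm
    obtain ⟨hlo, hhi⟩ := bThresh_mem_Ioc_of_bseq_ne hne
    have hpow : (0 : ℝ) < 2 ^ k := by positivity
    have hlow : c ≤ bThreshCell k m :=
      Int.ceil_le_ceil (mul_le_mul_of_nonneg_left hlo.le hpow.le)
    have hhigh : bThreshCell k m ≤ c + 1 := by
      rw [hc, ← Int.ceil_add_one]
      refine Int.ceil_le_ceil ?_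
      have hgap : bThresh m - min r s ≤ (1 / 2) ^ k := by
        rw [← max_sub_min_eq_abs'] at h
        linarith
      calc (2 : ℝ) ^ k * bThresh m
          = 2 ^ k * min r s + 2 ^ k * (bThresh m - min r s) := by ring
        _ ≤ 2 ^ k * min r s + 2 ^ k * (1 / 2) ^ k := by gcongr
        _ = 2 ^ k * min r s + 1 := by rw [← mul_pow]; norm_num
    simp only [Finset.mem_union, Finset.mem_filter, hmN, true_and]
    omega
  refine (Finset.card_le_card hsub).trans ((Finset.card_union_le _ _).trans ?_)
  have h1 := card_filter_bThreshCell_eq_le k N c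
  have h2 := card_filter_bThreshCell_eq_le k N (c + 1)
  omega

lemma besic_bseq_le (k : ℕ) {r s : ℝ} (h : |r - s| < (1 / 2) ^ k) :
    besic (bseq r) (bseq s) ≤ 4 * (1 / 2) ^ k := by
  refine Filter.limsup_le_of_le
    (Filter.isCoboundedUnder_le_of_le Filter.atTop (x := 0) fun n => by positivity) ?_
  filter_upwards [Filter.eventually_ge_atTop (2 ^ k)] with N hN
  have hpow : 0 < 2 ^ k := by positivity
  have hNpos : (0 : ℝ) < N := by exact_mod_cast hpow.trans_le hN
  rw [div_le_iff₀ hNpos]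
  have hcard : (((Finset.range N).filter (fun m => bseq r m ≠ bseq s m)).card : ℝ) ≤
      2 * (((N / 2 ^ k : ℕ) : ℝ) + 1) := by
    exact_mod_cast card_filter_bseq_ne_le k N h
  have hdiv : ((N / 2 ^ k : ℕ) : ℝ) ≤ N * (1 / 2) ^ k := by
    refine Nat.cast_div_le.trans_eq ?_
    push_cast
    rw [one_div, inv_pow, div_eq_mul_inv]
  have hone : (1 : ℝ) ≤ N * (1 / 2) ^ k := by
    have hN' : (2 : ℝ) ^ k ≤ N := by exact_mod_cast hN
    calc (1 : ℝ) = 2 ^ k * (1 / 2) ^ k := by rw [← mul_pow]; norm_num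
      _ ≤ N * (1 / 2) ^ k := by gcongr
  linarith

/-- The map `b : [0,1] -> 2^omega` is continuous with respect to the Besicovitch
pseudodistance. -/
theorem stmt_4 :
    ∀ r ∈ Set.Icc (0 : ℝ) 1, ∀ ε > (0 : ℝ), ∃ δ > (0 : ℝ),
      ∀ r' ∈ Set.Icc (0 : ℝ) 1, |r - r'| < δ → besic (bseq r) (bseq r') < ε := by
  intro r _ ε hε
  obtain ⟨k, hk⟩ := exists_pow_lt_of_lt_one (show (0 : ℝ) < ε / 4 by positivity)
    (show (1 / 2 : ℝ) < 1 by norm_num)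
  refine ⟨(1 / 2) ^ k, by positivity, fun r' _ h => ?_⟩
  linarith [besic_bseq_le k h]
end

section
/- Let s ∈ (0,1), let c = 1 − 2^{s−1}, and define f : [0,1/2] → ℝ by f(d) = s − 1 + H(d) if d ≥ c and f(d) = ((s − 1 + H(c))/c)·d if d < c. Then for every d ∈ [0,1/2], s − 1 + H(d) ≤ f(d) ≤ ((s − 1 + H(c))/c)·d. -/
/-- The binary entropy function `H(p) = -p log2 p - (1-p) log2 (1-p)`
(with `H(0) = H(1) = 0`, using the convention `logb 2 0 = 0`). -/
noncomputable def H (p : ℝ) : ℝ :=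
  -p * Real.logb 2 p - (1 - p) * Real.logb 2 (1 - p)

/-- The function `f` from the calculus lemma: `f(d) = s - 1 + H(d)` for `d >= c` and
`f(d) = ((s - 1 + H(c))/c) d` for `d < c`, where `c = 1 - 2^(s-1)`. -/
noncomputable def fGMSW (s d : ℝ) : ℝ :=
  if 1 - (2 : ℝ) ^ (s - 1) ≤ d then s - 1 + H d
  else ((s - 1 + H (1 - (2 : ℝ) ^ (s - 1))) / (1 - (2 : ℝ) ^ (s - 1))) * d

/-- The tangent-line inequality behind Gibbs' inequality: `x log (y / x) ≤ y - x`. -/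
lemma mul_log_sub_log_le {x y : ℝ} (hx : 0 ≤ x) (hy : 0 < y) :
    x * (Real.log y - Real.log x) ≤ y - x := by
  rcases hx.eq_or_lt with rfl | hx
  · simpa using hy.le
  · rw [← Real.log_div hy.ne' hx.ne']
    calc x * Real.log (y / x) ≤ x * (y / x - 1) :=
          mul_le_mul_of_nonneg_left (Real.log_le_sub_one_of_pos (div_pos hy hx)) hx.le
      _ = y - x := by field_simp

/-- Gibbs' inequality: the entropy is at most the cross entropy. -/
lemma H_le_cross_entropy {c d : ℝ} (hc₀ : 0 < c) (hc₁ : c < 1) (hd₀ : 0 ≤ d) (hd₁ : d ≤ 1) :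
    H d ≤ -d * Real.logb 2 c - (1 - d) * Real.logb 2 (1 - c) := by
  have h₁ := mul_log_sub_log_le hd₀ hc₀
  have h₂ := mul_log_sub_log_le (sub_nonneg.2 hd₁) (sub_pos.2 hc₁)
  have hlog : 0 < Real.log 2 := Real.log_pos one_lt_two
  simp only [H, Real.logb, ← mul_div_assoc, ← sub_div]
  refine div_le_div_of_nonneg_right ?_ hlog.le
  linarith

/-- The line through the origin and `(c, s - 1 + H c)`, where `c = 1 - 2 ^ (s - 1)`,
is tangent to the graph of `s - 1 + H` and lies above it. -/
lemma add_H_le_tangent {s d : ℝ} (hs : s < 1) (hd₀ : 0 ≤ d) (hd₁ : d ≤ 1) :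
    s - 1 + H d ≤ ((s - 1 + H (1 - (2 : ℝ) ^ (s - 1))) / (1 - (2 : ℝ) ^ (s - 1))) * d := by
  have hpos : (0 : ℝ) < 2 ^ (s - 1) := by positivity
  have hlt : (2 : ℝ) ^ (s - 1) < 1 :=
    Real.rpow_lt_one_of_one_lt_of_neg one_lt_two (sub_neg.2 hs)
  have hlogb : Real.logb 2 ((2 : ℝ) ^ (s - 1)) = s - 1 :=
    Real.logb_rpow two_pos (by norm_num)
  generalize (2 : ℝ) ^ (s - 1) = q at *
  have hc : 0 < 1 - q := sub_pos.2 hlt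
  have hslope : (s - 1 + H (1 - q)) / (1 - q) = s - 1 - Real.logb 2 (1 - q) := by
    rw [div_eq_iff hc.ne', H, sub_sub_cancel, hlogb]
    ring
  have hgibbs := H_le_cross_entropy hc (sub_lt_self 1 hpos) hd₀ hd₁
  rw [sub_sub_cancel, hlogb] at hgibbs
  rw [hslope]
  linarith

/-- For `s` in `(0,1)`, `c = 1 - 2^(s-1)`, and every `d` in `[0, 1/2]`,
`s - 1 + H(d) <= f(d) <= ((s - 1 + H(c))/c) d`. -/
theorem stmt_14 (s : ℝ) (hs : s ∈ Set.Ioo (0 : ℝ) 1) (d : ℝ)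
    (hd : d ∈ Set.Icc (0 : ℝ) (1 / 2)) :
    s - 1 + H d ≤ fGMSW s d ∧
    fGMSW s d
      ≤ ((s - 1 + H (1 - (2 : ℝ) ^ (s - 1))) / (1 - (2 : ℝ) ^ (s - 1))) * d := by
  have key := add_H_le_tangent hs.2 hd.1 (hd.2.trans (by norm_num))
  unfold fGMSW
  split_ifs
  · exact ⟨le_rfl, key⟩
  · exact ⟨key, le_rfl⟩
end
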